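/- Let f : ℝ → ℝ be a measurable function that grows at most linearly, let W ∈ ℝ^{D×D} and b ∈ ℝ^D be fixed, let E ∈ ℝ^{m×D} be a standard Gaussian matrix, and let B ∈ ℝ^{m×D} be the matrix whose every row equals bᵀ. For a unit vector γ ∈ ℝ^D set E_γ := E[(∑_{j=1}^D f((Wε + b)_j) γ_j)²] where ε ~ N(0, I_D). Then there exist constants C, c > 0, depending only on f, W and b, such that for every ε ∈ (0, 1) and every finite subset N_ε of the unit sphere S^{D−1} with |N_ε| ≤ (1 + 2/ε)^D: if m ≥ C · (D/ε²) · log(2/ε), then with probability at least 1 − exp(−c m ε²), simultaneously for all γ ∈ N_ε, E_γ − ε ≤ (1/m) ‖f(EWᵀ + B) γ‖₂² ≤ E_γ + ε. -/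

import Mathlib

open MeasureTheory ProbabilityTheory

lemma Real.exp_le_one_add_add_sq_mul_exp_abs (x : ℝ) :
    Real.exp x ≤ 1 + x + x ^ 2 * Real.exp |x| := by
  have h := Complex.norm_exp_sub_sum_le_norm_mul_exp (x : ℂ) 2
  have e : Complex.exp (x : ℂ) - ∑ i ∈ Finset.range 2, (x : ℂ) ^ i / (i.factorial : ℂ)
      = ((Real.exp x - (1 + x) : ℝ) : ℂ) := by
    simp [Finset.sum_range_succ]
  rw [e, Complex.norm_real, Complex.norm_real, Real.norm_eq_abs, Real.norm_eq_abs, sq_abs] at h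
  linarith [le_abs_self (Real.exp x - (1 + x))]

section Subexponential

variable {E : Type*} [MeasurableSpace E] {ν : Measure E} [IsProbabilityMeasure ν] {V : E → ℝ}
  {s : ℝ}

/-- A function dominated by `V`, where `exp (s * V)` is integrable, has a centred moment generating
function that is sub-Gaussian near `0`, with constants that depend on `V` and `s` only. -/
lemma exists_integral_exp_centered_le (hs : 0 < s) (hVm : AEStronglyMeasurable V ν)
    (hV0 : ∀ x, 0 ≤ V x) (hV : Integrable (fun x ↦ Real.exp (s * V x)) ν) :
    ∃ K : ℝ, 0 < K ∧ ∀ g : E → ℝ, AEStronglyMeasurable g ν → (∀ x, |g x| ≤ V x) →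
      ∀ t : ℝ, |t| ≤ s / 2 →
        Integrable (fun x ↦ Real.exp (t * (g x - ∫ y, g y ∂ν))) ν ∧
          ∫ x, Real.exp (t * (g x - ∫ y, g y ∂ν)) ∂ν ≤ Real.exp (K * t ^ 2) := by
  have hVi : Integrable V ν := by
    refine (hV.const_mul s⁻¹).mono' hVm (.of_forall fun x ↦ ?_)
    rw [Real.norm_of_nonneg (hV0 x), ← div_eq_inv_mul, le_div_iff₀ hs, mul_comm]
    linarith [Real.add_one_le_exp (s * V x)]
  set M := ∫ y, V y ∂ν with hM
  set H : E → ℝ := fun x ↦ 8 / s ^ 2 * Real.exp (s * M) * Real.exp (s * V x) with hH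
  have hHi : Integrable H ν := hV.const_mul _
  have hHpos (x : E) : 0 < H x := by positivity
  refine ⟨∫ x, H x ∂ν, ?_, fun g hgm hg t ht ↦ ?_⟩
  · exact (integral_pos_iff_support_of_nonneg (fun x ↦ (hHpos x).le) hHi).2 (by
      have : Function.support H = Set.univ := by
        ext x; simpa using (hHpos x).ne'
      simp [this])
  have hgi : Integrable g ν := hVi.mono' hgm (.of_forall hg)
  set Z : E → ℝ := fun x ↦ g x - ∫ y, g y ∂ν with hZ
  have hZi : Integrable Z ν := hgi.sub (integrable_const _)
  have hZ0 : ∫ x, Z x ∂ν = 0 := by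
    simp [hZ, integral_sub hgi (integrable_const _)]
  have hZle (x : E) : |Z x| ≤ V x + M := by
    refine (abs_sub _ _).trans (add_le_add (hg x) ?_)
    exact (norm_integral_le_integral_norm g).trans
      (integral_mono hgi.norm hVi hg)
  have hM0 : 0 ≤ M := integral_nonneg hV0
  have key (x : E) : Z x ^ 2 * Real.exp |t * Z x| ≤ H x := by
    have hU : 0 ≤ V x + M := add_nonneg (hV0 x) hM0
    have h1 : |t * Z x| ≤ s / 2 * (V x + M) := by
      rw [abs_mul]; exact mul_le_mul ht (hZle x) (abs_nonneg _) (by positivity)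
    have h2 : Z x ^ 2 ≤ 8 / s ^ 2 * Real.exp (s / 2 * (V x + M)) := by
      have h3 := Real.quadratic_le_exp_of_nonneg (x := s / 2 * (V x + M)) (by positivity)
      have h4 : Z x ^ 2 ≤ (V x + M) ^ 2 := by
        rw [← sq_abs]; gcongr; exact hZle x
      have h5 : 0 ≤ s / 2 * (V x + M) := by positivity
      rw [div_mul_eq_mul_div, le_div_iff₀ (by positivity)]
      nlinarith [mul_le_mul_of_nonneg_right h4 (sq_nonneg s)]
    calc Z x ^ 2 * Real.exp |t * Z x|
        ≤ 8 / s ^ 2 * Real.exp (s / 2 * (V x + M)) * Real.exp (s / 2 * (V x + M)) := by gcongr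
      _ = H x := by
        simp only [hH]
        rw [mul_assoc, mul_assoc, ← Real.exp_add, ← Real.exp_add]
        congr 2; ring
  have hbound (x : E) : Real.exp (t * Z x) ≤ 1 + t * Z x + t ^ 2 * H x := by
    have h1 := Real.exp_le_one_add_add_sq_mul_exp_abs (t * Z x)
    have h2 := mul_le_mul_of_nonneg_left (key x) (sq_nonneg t)
    rw [mul_pow, mul_assoc] at h1
    linarith
  have hRi : Integrable (fun x ↦ 1 + t * Z x + t ^ 2 * H x) ν :=
    ((integrable_const _).add (hZi.const_mul t)).add (hHi.const_mul _)
  have hei : Integrable (fun x ↦ Real.exp (t * Z x)) ν := by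
    refine hRi.mono' (Real.continuous_exp.comp_aestronglyMeasurable
      (hZi.aestronglyMeasurable.const_mul t)) (.of_forall fun x ↦ ?_)
    rw [Real.norm_of_nonneg (Real.exp_nonneg _)]
    exact hbound x
  refine ⟨hei, (integral_mono hei hRi hbound).trans ?_⟩
  have : ∫ x, (1 + t * Z x + t ^ 2 * H x) ∂ν = 1 + t ^ 2 * ∫ x, H x ∂ν := by
    have h1 : Integrable (fun x ↦ 1 + t * Z x) ν := (integrable_const _).add (hZi.const_mul t)
    rw [integral_add h1 (hHi.const_mul _), integral_add (integrable_const _) (hZi.const_mul t),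
      integral_const_mul, integral_const_mul, hZ0]
    simp
  rw [this]
  linarith [Real.add_one_le_exp ((∫ x, H x ∂ν) * t ^ 2)]

/-- Bernstein's inequality, in the regime of small deviations, for sums of independent copies of a
function dominated by `V`, where `exp (s * V)` is integrable. -/
lemma exists_measureReal_sum_centered_ge_le (hs : 0 < s) (hVm : AEStronglyMeasurable V ν)
    (hV0 : ∀ x, 0 ≤ V x) (hV : Integrable (fun x ↦ Real.exp (s * V x)) ν) :
    ∃ c : ℝ, 0 < c ∧ ∀ g : E → ℝ, AEStronglyMeasurable g ν → (∀ x, |g x| ≤ V x) →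
      ∀ (m : ℕ) (ε : ℝ), 0 ≤ ε → ε ≤ 1 →
        (Measure.pi fun _ : Fin m ↦ ν).real
          {ω | m * ε ≤ ∑ i, (g (ω i) - ∫ y, g y ∂ν)} ≤ Real.exp (-(c * m * ε ^ 2)) := by
  obtain ⟨K, hK, h⟩ := exists_integral_exp_centered_le hs hVm hV0 hV
  set τ := min (s / 2) (1 / (2 * K)) with hτ
  have hτ0 : 0 < τ := lt_min (by positivity) (by positivity)
  have hτK : K * τ ≤ 1 / 2 := by
    have := mul_le_mul_of_nonneg_left (min_le_right (s / 2) (1 / (2 * K))) hK.le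
    refine this.trans_eq ?_
    field_simp
  refine ⟨τ / 2, by positivity, fun g hgm hg m ε hε0 hε1 ↦ ?_⟩
  obtain ⟨hi, hle⟩ := h g hgm hg (τ * ε) (by
    rw [abs_of_nonneg (by positivity)]
    exact (mul_le_of_le_one_right hτ0.le hε1).trans (min_le_left _ _))
  have hexp (ω : Fin m → E) : Real.exp (τ * ε * ∑ i, (g (ω i) - ∫ y, g y ∂ν))
      = ∏ i, Real.exp (τ * ε * (g (ω i) - ∫ y, g y ∂ν)) := by
    rw [Finset.mul_sum, Real.exp_sum]
  refine (measure_ge_le_exp_mul_mgf (t := τ * ε) _ (by positivity) ?_).trans ?_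
  · simp_rw [hexp]
    exact Integrable.fintype_prod fun _ ↦ hi
  · have hmgf : mgf (fun ω : Fin m → E ↦ ∑ i, (g (ω i) - ∫ y, g y ∂ν))
        (Measure.pi fun _ : Fin m ↦ ν) (τ * ε)
        = (∫ x, Real.exp (τ * ε * (g x - ∫ y, g y ∂ν)) ∂ν) ^ m := by
      simp_rw [mgf, hexp]
      simpa using integral_fintype_prod_eq_pow (ι := Fin m) (μ := ν)
        (fun x ↦ Real.exp (τ * ε * (g x - ∫ y, g y ∂ν)))
    rw [hmgf]
    calc _ ≤ Real.exp (-(τ * ε) * (m * ε)) * (Real.exp (K * (τ * ε) ^ 2)) ^ m := by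
          gcongr
      _ = Real.exp (-(τ * ε) * (m * ε) + m * (K * (τ * ε) ^ 2)) := by
          rw [← Real.exp_nat_mul, ← Real.exp_add]
      _ ≤ _ := by
          rw [Real.exp_le_exp]
          have h1 := mul_le_mul_of_nonneg_right hτK
            (show 0 ≤ m * τ * ε ^ 2 by positivity)
          nlinarith

end Subexponential

lemma exists_integrable_exp_sum_sq_gaussian (ι : Type*) [Fintype ι] :
    ∃ s : ℝ, 0 < s ∧ Integrable (fun x : ι → ℝ ↦ Real.exp (s * ∑ k, x k ^ 2))
      (Measure.pi fun _ : ι ↦ gaussianReal 0 1) := by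
  obtain ⟨s, hs, h⟩ := IsGaussian.exists_integrable_exp_sq (gaussianReal 0 1)
  refine ⟨s, hs, ?_⟩
  simp_rw [Finset.mul_sum, Real.exp_sum]
  exact Integrable.fintype_prod (f := fun _ y ↦ Real.exp (s * y ^ 2)) fun _ ↦ by simpa using h

/-- Splitting a standard Gaussian matrix into its rows preserves the measure. -/
lemma measurePreserving_curry_gaussian (ι κ : Type*) [Fintype ι] [Fintype κ] :
    MeasurePreserving (MeasurableEquiv.curry ι κ ℝ)
      (Measure.pi fun _ : ι × κ ↦ gaussianReal 0 1)
      (Measure.pi fun _ : ι ↦ Measure.pi fun _ : κ ↦ gaussianReal 0 1) := by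
  refine ⟨MeasurableEquiv.measurable _, ?_⟩
  have := Measure.infinitePi_map_curry (ι := ι) (κ := κ) fun _ _ ↦ gaussianReal 0 1
  simpa only [Measure.infinitePi_eq_pi] using this

/-- A linear readout, with weights on the unit sphere, of a layer whose activation grows at most
linearly is bounded by a quadratic function of the input, uniformly in the weights. -/
lemma exists_sq_readout_le {D : ℕ} {f : ℝ → ℝ} {a b₀ : ℝ}
    (hgrow : ∀ x, |f x| ≤ a * |x| + b₀) (W : Matrix (Fin D) (Fin D) ℝ) (b : Fin D → ℝ) :
    ∃ A B : ℝ, 0 < A ∧ 0 ≤ B ∧ ∀ γ : Fin D → ℝ, ∑ j, γ j ^ 2 = 1 → ∀ x : Fin D → ℝ,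
      (∑ j, f (∑ k, W j k * x k + b j) * γ j) ^ 2 ≤ A * ∑ k, x k ^ 2 + B := by
  refine ⟨4 * a ^ 2 * (∑ j, ∑ k, W j k ^ 2) + 1, ∑ j, (4 * a ^ 2 * b j ^ 2 + 2 * b₀ ^ 2),
    by positivity, by positivity, fun γ hγ x ↦ ?_⟩
  have h1 := Finset.sum_mul_sq_le_sq_mul_sq Finset.univ
    (fun j ↦ f (∑ k, W j k * x k + b j)) γ
  rw [hγ, mul_one] at h1
  have h2 (j : Fin D) : f (∑ k, W j k * x k + b j) ^ 2
      ≤ 4 * a ^ 2 * (∑ k, W j k ^ 2) * (∑ k, x k ^ 2) + (4 * a ^ 2 * b j ^ 2 + 2 * b₀ ^ 2) := by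
    set u := ∑ k, W j k * x k with hu
    have h3 : u ^ 2 ≤ (∑ k, W j k ^ 2) * ∑ k, x k ^ 2 :=
      Finset.sum_mul_sq_le_sq_mul_sq Finset.univ (W j) x
    have h4 : f (u + b j) ^ 2 ≤ (a * |u + b j| + b₀) ^ 2 := by
      rw [← sq_abs]; gcongr; exact hgrow _
    have h5 : (a * |u + b j| + b₀) ^ 2 ≤ 2 * a ^ 2 * (u + b j) ^ 2 + 2 * b₀ ^ 2 := by
      rw [← sq_abs (u + b j)]; nlinarith [sq_nonneg (a * |u + b j| - b₀)]
    have h6 : (u + b j) ^ 2 ≤ 2 * u ^ 2 + 2 * b j ^ 2 := by nlinarith [sq_nonneg (u - b j)]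
    have h7 := mul_le_mul_of_nonneg_left h6 (show 0 ≤ 2 * a ^ 2 by positivity)
    have h8 := mul_le_mul_of_nonneg_left h3 (show 0 ≤ 4 * a ^ 2 by positivity)
    linarith
  refine h1.trans ((Finset.sum_le_sum fun j _ ↦ h2 j).trans ?_)
  rw [Finset.sum_add_distrib, ← Finset.sum_mul, ← Finset.mul_sum]
  have : 0 ≤ ∑ k, x k ^ 2 := by positivity
  linarith

/-- The union bound over an `ε`-net costs only half of the exponent once `m` is large. -/
lemma two_mul_card_mul_exp_le {D N m : ℕ} {c ε : ℝ} (hc : 0 < c) (hε : ε ∈ Set.Ioo (0 : ℝ) 1)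
    (hD : D ≠ 0) (hN : (N : ℝ) ≤ (1 + 2 / ε) ^ D)
    (hm : 6 / c * ((D : ℝ) / ε ^ 2) * Real.log (2 / ε) ≤ m) :
    2 * N * Real.exp (-(c * m * ε ^ 2)) ≤ Real.exp (-(c / 2 * m * ε ^ 2)) := by
  obtain ⟨h0, h1⟩ := hε
  have hy : 2 ≤ 2 / ε := by rw [le_div_iff₀ h0]; linarith
  set y := 2 / ε with hydef
  have h2N : 2 * (N : ℝ) ≤ y ^ (3 * D) := by
    calc 2 * (N : ℝ) ≤ y ^ D * (y ^ 2) ^ D := by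
          gcongr
          · exact hy.trans (le_self_pow₀ (by linarith) hD)
          · exact hN.trans (by gcongr; nlinarith)
      _ = y ^ (3 * D) := by rw [← pow_mul, ← pow_add]; congr 1; ring
  have hlog : (3 * D : ℝ) * Real.log y ≤ c / 2 * m * ε ^ 2 := by
    have h3 := mul_le_mul_of_nonneg_right hm (show 0 ≤ c / 2 * ε ^ 2 by positivity)
    calc (3 * D : ℝ) * Real.log y
        = 6 / c * ((D : ℝ) / ε ^ 2) * Real.log y * (c / 2 * ε ^ 2) := by field_simp; ring
      _ ≤ _ := h3
      _ = _ := by ring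
  have hpow : y ^ (3 * D) ≤ Real.exp (c / 2 * m * ε ^ 2) := by
    rw [← Real.exp_log (show 0 < y ^ (3 * D) by positivity), Real.log_pow, Real.exp_le_exp]
    exact_mod_cast hlog
  calc _ ≤ Real.exp (c / 2 * m * ε ^ 2) * Real.exp (-(c * m * ε ^ 2)) := by
        gcongr; exact h2N.trans hpow
    _ = _ := by rw [← Real.exp_add]; congr 1; ring

/-- For measurable `f : ℝ → ℝ` growing at most linearly, fixed `W, b`, a
standard Gaussian matrix `E ∈ ℝ^{m×D}` and `B` whose rows all equal `bᵀ`, with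
`E_γ := E[(∑ j, f((Wε + b) j) * γ j)²]` for `ε ~ N(0, I_D)`, there are constants
`C, c > 0` depending only on `f, W, b` such that for every `ε ∈ (0,1)` and any finite
subset `N_ε` of the unit sphere with `|N_ε| ≤ (1 + 2/ε)^D`, if `m ≥ C (D/ε²) log(2/ε)`
then with probability at least `1 − exp(−c m ε²)`, simultaneously for all `γ ∈ N_ε`,
`E_γ − ε ≤ (1/m) ‖f(EWᵀ + B) γ‖₂² ≤ E_γ + ε`. -/
theorem stmt_5 (D : ℕ) (f : ℝ → ℝ) (hf : Measurable f)
    (a b₀ : ℝ) (ha : 0 ≤ a) (hb₀ : 0 ≤ b₀) (hgrow : ∀ x, |f x| ≤ a * |x| + b₀)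
    (W : Matrix (Fin D) (Fin D) ℝ) (b : Fin D → ℝ) :
    ∃ C c : ℝ, 0 < C ∧ 0 < c ∧
      ∀ (m : ℕ) (ε : ℝ), ε ∈ Set.Ioo (0 : ℝ) 1 →
        ∀ Nε : Finset (Fin D → ℝ),
          (∀ γ ∈ Nε, ∑ j, (γ j) ^ 2 = 1) →
          ((Nε.card : ℝ) ≤ (1 + 2 / ε) ^ D) →
          C * ((D : ℝ) / ε ^ 2) * Real.log (2 / ε) ≤ (m : ℝ) →
          1 - ENNReal.ofReal (Real.exp (-(c * m * ε ^ 2))) ≤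
            (Measure.pi fun _ : Fin m × Fin D => gaussianReal 0 1)
              {ω | ∀ γ ∈ Nε,
                (∫ x : Fin D → ℝ, (∑ j, f (∑ k, W j k * x k + b j) * γ j) ^ 2
                    ∂(Measure.pi fun _ : Fin D => gaussianReal 0 1)) - ε
                  ≤ (1 / (m : ℝ)) * ∑ i : Fin m,
                      (∑ j, f (∑ k, ω (i, k) * W j k + b j) * γ j) ^ 2
                ∧ (1 / (m : ℝ)) * ∑ i : Fin m,
                      (∑ j, f (∑ k, ω (i, k) * W j k + b j) * γ j) ^ 2
                  ≤ (∫ x : Fin D → ℝ, (∑ j, f (∑ k, W j k * x k + b j) * γ j) ^ 2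
                      ∂(Measure.pi fun _ : Fin D => gaussianReal 0 1)) + ε} := by
  classical
  obtain ⟨s, hs, hsi⟩ := exists_integrable_exp_sum_sq_gaussian (Fin D)
  obtain ⟨A, B, hA, hB, hAB⟩ := exists_sq_readout_le hgrow W b
  set ν : Measure (Fin D → ℝ) := Measure.pi fun _ : Fin D => gaussianReal 0 1 with hν
  set V : (Fin D → ℝ) → ℝ := fun x ↦ A * ∑ k, x k ^ 2 + B with hV
  have hVi : Integrable (fun x ↦ Real.exp (s / A * V x)) ν := by
    refine (hsi.const_mul (Real.exp (s / A * B))).congr (.of_forall fun x ↦ ?_)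
    simp only [hV]
    rw [← Real.exp_add]
    congr 1
    field_simp
    ring
  have hVm : AEStronglyMeasurable V ν := by
    refine Continuous.aestronglyMeasurable ?_
    simp only [hV]
    fun_prop
  obtain ⟨c, hc, hbern⟩ := exists_measureReal_sum_centered_ge_le (div_pos hs hA) hVm
    (fun x ↦ by positivity) hVi
  refine ⟨6 / c, c / 2, by positivity, by positivity, fun m ε hε N hN hcard hm ↦ ?_⟩
  set P : Measure (Fin m × Fin D → ℝ) :=
    Measure.pi fun _ : Fin m × Fin D => gaussianReal 0 1 with hP
  set S := {ω : Fin m × Fin D → ℝ | ∀ γ ∈ N,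
    (∫ x, (∑ j, f (∑ k, W j k * x k + b j) * γ j) ^ 2 ∂ν) - ε
        ≤ (1 / (m : ℝ)) * ∑ i : Fin m, (∑ j, f (∑ k, ω (i, k) * W j k + b j) * γ j) ^ 2
      ∧ (1 / (m : ℝ)) * ∑ i : Fin m, (∑ j, f (∑ k, ω (i, k) * W j k + b j) * γ j) ^ 2
        ≤ (∫ x, (∑ j, f (∑ k, W j k * x k + b j) * γ j) ^ 2 ∂ν) + ε} with hS
  rcases Nat.eq_zero_or_pos m with rfl | hm0
  · simp
  have hm0' : (0 : ℝ) < m := by exact_mod_cast hm0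
  set g : (Fin D → ℝ) → (Fin D → ℝ) → ℝ :=
    fun γ x ↦ (∑ j, f (∑ k, W j k * x k + b j) * γ j) ^ 2 with hg
  have hgm (γ : Fin D → ℝ) : Measurable (g γ) := by
    simp only [hg]
    refine (Finset.measurable_sum _ fun j _ ↦ ?_).pow_const 2
    exact (hf.comp (by fun_prop)).mul_const _
  have hgV (γ) (hγ : γ ∈ N) (x) : |g γ x| ≤ V x := by
    rw [abs_of_nonneg (sq_nonneg _)]; exact hAB γ (hN γ hγ) x
  set F := MeasurableEquiv.curry (Fin m) (Fin D) ℝ with hF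
  set T : ((Fin D → ℝ) → ℝ) → Set (Fin m → Fin D → ℝ) :=
    fun h ↦ {ω | m * ε ≤ ∑ i, (h (ω i) - ∫ y, h y ∂ν)} with hT
  have htail (h : (Fin D → ℝ) → ℝ) (hhm : Measurable h) (hhV : ∀ x, |h x| ≤ V x) :
      P.real (F ⁻¹' T h) ≤ Real.exp (-(c * m * ε ^ 2)) := by
    have hTm : MeasurableSet (T h) := by
      refine measurableSet_le measurable_const ?_
      exact Finset.measurable_sum _ fun i _ ↦
        (hhm.comp (measurable_pi_apply i)).sub measurable_const
    rw [(measurePreserving_curry_gaussian (Fin m) (Fin D)).measureReal_preimage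
      hTm.nullMeasurableSet]
    exact hbern h hhm.aestronglyMeasurable hhV m ε hε.1.le hε.2.le
  have hcompl : Sᶜ ⊆ ⋃ γ ∈ N, (F ⁻¹' T (g γ) ∪ F ⁻¹' T (-g γ)) := by
    intro ω hω
    simp only [hS, Set.mem_compl_iff, Set.mem_ofPred_eq, not_forall] at hω
    obtain ⟨γ, hγ, hω⟩ := hω
    refine Set.mem_biUnion hγ ?_
    have hsum : ∑ i : Fin m, (∑ j, f (∑ k, ω (i, k) * W j k + b j) * γ j) ^ 2
        = ∑ i, g γ (F ω i) := by
      refine Finset.sum_congr rfl fun i _ ↦ ?_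
      simp [hg, hF, mul_comm (W _ _)]
    rw [hsum, one_div_mul_eq_div, le_div_iff₀ hm0', div_le_iff₀ hm0', not_and_or,
      not_le, not_le] at hω
    simp only [Set.mem_union, Set.mem_preimage, hT, Set.mem_ofPred_eq, Pi.neg_apply, integral_neg,
      Finset.sum_sub_distrib, Finset.sum_neg_distrib, Finset.sum_const, Finset.card_univ,
      Fintype.card_fin, nsmul_eq_mul]
    simp only [hg] at hω ⊢
    rcases hω with hω | hω
    · right; linarith
    · left; linarith
  have hbad : P.real Sᶜ ≤ Real.exp (-(c / 2 * m * ε ^ 2)) := by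
    rcases eq_or_ne D 0 with rfl | hD
    · have : N = ∅ := Finset.eq_empty_of_forall_notMem fun γ hγ ↦ by simpa using hN γ hγ
      simp [hS, this, Real.exp_nonneg]
    calc P.real Sᶜ ≤ P.real (⋃ γ ∈ N, (F ⁻¹' T (g γ) ∪ F ⁻¹' T (-g γ))) :=
          measureReal_mono hcompl (measure_ne_top _ _)
      _ ≤ ∑ γ ∈ N, P.real (F ⁻¹' T (g γ) ∪ F ⁻¹' T (-g γ)) := measureReal_biUnion_finset_le _ _
      _ ≤ ∑ γ ∈ N, 2 * Real.exp (-(c * m * ε ^ 2)) := by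
        refine Finset.sum_le_sum fun γ hγ ↦ (measureReal_union_le _ _).trans ?_
        rw [two_mul]
        exact add_le_add (htail _ (hgm γ) (hgV γ hγ))
          (htail _ (hgm γ).neg fun x ↦ by simpa using hgV γ hγ x)
      _ = 2 * N.card * Real.exp (-(c * m * ε ^ 2)) := by
        rw [Finset.sum_const, nsmul_eq_mul]; ring
      _ ≤ _ := two_mul_card_mul_exp_le hc hε hD hcard hm
  rw [tsub_le_iff_right]
  calc (1 : ENNReal) = P (S ∪ Sᶜ) := by rw [Set.union_compl_self, measure_univ]
    _ ≤ P S + P Sᶜ := measure_union_le _ _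
    _ ≤ _ := by
      gcongr
      rw [← ofReal_measureReal]
      exact ENNReal.ofReal_le_ofReal hbad
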